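/- Fix n ≥ 1. Let (a_j)_{j ∈ ℤ} and (b_j)_{j ∈ ℤ} be finitely supported families of matrices in Matrix (Fin n) (Fin n) ℂ such that f(z) := ∑_j a_j z^j and g(z) := ∑_j b_j z^j are unitary for every z ∈ ℂ with ‖z‖ = 1 and satisfy f(1) = g(1) = identity matrix. If closure(M_f(K₊)) = closure(M_g(K₊)), then a_j = b_j for all j (equivalently, f(z) = g(z) for all z on the unit circle). That is, a based polynomial unitary loop is uniquely determined by its associated subspace W_f in the Grassmannian. -/

import Mathlib

noncomputable section

/-- The Hilbert space `K = ℓ²(ℤ, ℂⁿ)`, the model of `L²(S¹) ⊗ ℂⁿ`. -/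
abbrev KSpN (n : ℕ) := lp (fun _ : ℤ => EuclideanSpace ℂ (Fin n)) 2

section Helpers

/-- The character `z ↦ z ^ j` of the circle. -/
def zchar (j : ℤ) : Circle →* ℂ where
  toFun z := (z : ℂ) ^ j
  map_one' := by simp
  map_mul' x y := by rw [Circle.coe_mul, mul_zpow]

lemma zpow_char_inj : Function.Injective zchar := by
  intro j k hjk
  by_contra hne
  set N : ℕ := (j - k).natAbs + 1 with hN
  have hp := Complex.isPrimitiveRoot_exp N (by omega)
  set z := Complex.exp (2 * Real.pi * Complex.I / N) with hz
  have hnorm : ‖z‖ = 1 := hp.norm'_eq_one (by omega)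
  have h1 := DFunLike.congr_fun hjk (⟨z, by simpa [Submonoid.unitSphere] using hnorm⟩ : Circle)
  have h2 : z ^ j = z ^ k := by exact h1
  have hz0 : z ≠ 0 := by rw [← norm_ne_zero_iff, hnorm]; exact one_ne_zero
  have h3 : z ^ (j - k) = 1 := by
    rw [zpow_sub₀ hz0, h2, div_self (zpow_ne_zero _ hz0)]
  have h4 := (hp.zpow_eq_one_iff_dvd _).1 h3
  have h5 := Int.natAbs_dvd_natAbs.2 h4
  have h6 := Nat.le_of_dvd (by omega) h5
  simp at h6
  omega

lemma laurent_zero (s : Finset ℤ) (c : ℤ → ℂ)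
    (h : ∀ z : ℂ, ‖z‖ = 1 → ∑ j ∈ s, z ^ j * c j = 0) : ∀ j ∈ s, c j = 0 := by
  have hli := (linearIndependent_monoidHom Circle ℂ).comp _ zpow_char_inj
  refine linearIndependent_iff'.1 hli s c ?_
  funext z
  have := h (z : ℂ) z.norm_coe
  simpa [mul_comm, zchar] using this

variable {n : ℕ}

lemma laurent_const (s : Finset ℤ) (c : ℤ → Matrix (Fin n) (Fin n) ℂ)
    (d : Matrix (Fin n) (Fin n) ℂ) (h0 : (0 : ℤ) ∈ s)
    (h : ∀ z : ℂ, ‖z‖ = 1 → ∑ j ∈ s, z ^ j • c j = d) :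
    ∀ j ∈ s, c j = if j = 0 then d else 0 := by
  intro j hj
  ext p q
  have := laurent_zero s (fun j => c j p q - if j = 0 then d p q else 0) ?_ j hj
  · rw [sub_eq_zero] at this
    rw [this]; split_ifs <;> rfl
  · intro z hz
    have h1 := congrFun (congrFun (h z hz) p) q
    simp only [mul_sub, Finset.sum_sub_distrib]
    simp [Matrix.sum_apply] at h1
    simp [h1, h0]

open Matrix

/-- The coefficients of `f* g`. -/
def corr (sa : Finset ℤ) (a b : ℤ → Matrix (Fin n) (Fin n) ℂ) (k : ℤ) :
    Matrix (Fin n) (Fin n) ℂ := ∑ j ∈ sa, (a j)ᴴ * b (k + j)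

lemma corr_sum {V : Type*} [AddCommMonoid V] (sa sb T : Finset ℤ)
    (a b : ℤ → Matrix (Fin n) (Fin n) ℂ) (hb : ∀ j : ℤ, j ∉ sb → b j = 0)
    (hT : ∀ j ∈ sa, ∀ i ∈ sb, i - j ∈ T) (G : ℤ → Matrix (Fin n) (Fin n) ℂ →+ V) :
    ∑ j ∈ sa, ∑ i ∈ sb, G (i - j) ((a j)ᴴ * b i) = ∑ l ∈ T, G l (corr sa a b l) := by
  simp only [corr, map_sum]
  rw [Finset.sum_comm (s := T)]
  refine Finset.sum_congr rfl fun j hj => ?_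
  have hsub : sb.image (fun i => i - j) ⊆ T := by
    intro l hl
    obtain ⟨i, hi, rfl⟩ := Finset.mem_image.1 hl
    exact hT j hj i hi
  rw [← Finset.sum_subset hsub, Finset.sum_image]
  · simp
  · intro x _ y _ h; simpa using h
  · intro l _ hl
    rw [hb (l + j), mul_zero, map_zero]
    intro hm
    exact hl (Finset.mem_image.2 ⟨l + j, hm, by ring⟩)

/-- all differences, plus `0` and `k`. -/
def dT (sa sb : Finset ℤ) (k : ℤ) : Finset ℤ :=
  insert 0 (insert k ((sa ×ˢ sb).image fun p => p.2 - p.1))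

lemma dT_mem (sa sb : Finset ℤ) (k : ℤ) : ∀ j ∈ sa, ∀ i ∈ sb, i - j ∈ dT sa sb k := by
  intro j hj i hi
  refine Finset.mem_insert_of_mem (Finset.mem_insert_of_mem (Finset.mem_image.2 ⟨(j, i), ?_, rfl⟩))
  simp [hj, hi]

lemma star_mul_eval (sa sb : Finset ℤ) (k : ℤ)
    (a b : ℤ → Matrix (Fin n) (Fin n) ℂ) (hb : ∀ j : ℤ, j ∉ sb → b j = 0) (z : ℂ) (hz : ‖z‖ = 1) :
    star (∑ j ∈ sa, z ^ j • a j) * (∑ j ∈ sb, z ^ j • b j)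
      = ∑ l ∈ dT sa sb k, z ^ l • corr sa a b l := by
  have := corr_sum sa sb (dT sa sb k) a b hb (dT_mem sa sb k)
    (fun l => DistribSMul.toAddMonoidHom _ (z ^ l))
  simp only [DistribSMul.toAddMonoidHom_apply] at this
  rw [← this, star_sum, Finset.sum_mul_sum]
  refine Finset.sum_congr rfl fun j _ => Finset.sum_congr rfl fun i _ => ?_
  have hz0 : z ≠ 0 := by rw [← norm_ne_zero_iff, hz]; exact one_ne_zero
  have hs : star z = z⁻¹ := (Complex.inv_eq_conj hz).symm
  rw [star_smul, Matrix.smul_mul, Matrix.mul_smul, smul_smul, star_zpow₀, hs, sub_eq_add_neg,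
    zpow_add₀ hz0, _root_.inv_zpow', mul_comm (z ^ (-j)), star_eq_conjTranspose]

lemma corr_self (sa : Finset ℤ) (a : ℤ → Matrix (Fin n) (Fin n) ℂ)
    (ha : ∀ j : ℤ, j ∉ sa → a j = 0)
    (haU : ∀ z : ℂ, ‖z‖ = 1 → (∑ j ∈ sa, z ^ j • a j) ∈ Matrix.unitaryGroup (Fin n) ℂ) (l : ℤ) :
    corr sa a a l = if l = 0 then 1 else 0 := by
  refine laurent_const (dT sa sa l) (corr sa a a) 1 (by simp [dT]) ?_ l (by simp [dT])
  intro z hz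
  rw [← star_mul_eval sa sa l a a ha z hz]
  exact (Matrix.mem_unitaryGroup_iff'.1 (haU z hz))

/-- Coordinate `k` of the adjoint of `M_f`. -/
def adjCoord (sa : Finset ℤ) (a : ℤ → Matrix (Fin n) (Fin n) ℂ) (k : ℤ) (y : KSpN n) :
    Fin n → ℂ := ∑ j ∈ sa, (a j)ᴴ *ᵥ (y (k + j)).ofLp

lemma adjCoord_cont (sa : Finset ℤ) (a : ℤ → Matrix (Fin n) (Fin n) ℂ) (k : ℤ) :
    Continuous (adjCoord sa a k) := by
  unfold adjCoord
  refine continuous_finset_sum _ fun j _ => ?_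
  refine Continuous.matrix_mulVec continuous_const ?_
  exact (PiLp.continuous_ofLp 2 _).comp (lp.lipschitzWith_one_eval 2 (k + j)).continuous

lemma adjCoord_Mf (sa : Finset ℤ) (a : ℤ → Matrix (Fin n) (Fin n) ℂ)
    (ha : ∀ j : ℤ, j ∉ sa → a j = 0)
    (haU : ∀ z : ℂ, ‖z‖ = 1 → (∑ j ∈ sa, z ^ j • a j) ∈ Matrix.unitaryGroup (Fin n) ℂ)
    (Mf : KSpN n → KSpN n)
    (hMf : ∀ (x : KSpN n) (m : ℤ), Mf x m = ∑ j ∈ sa, (a j).mulVec (x (m - j)))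
    (k : ℤ) (x : KSpN n) : adjCoord sa a k (Mf x) = (x k).ofLp := by
  have := corr_sum sa sa (dT sa sa 0) a a ha (dT_mem sa sa 0)
    (fun l => (Matrix.mulVec.addMonoidHomLeft (x (k - l)).ofLp))
  simp only [Matrix.mulVec.addMonoidHomLeft, AddMonoidHom.coe_mk, ZeroHom.coe_mk] at this
  simp only [corr_self sa a ha haU] at this
  rw [Finset.sum_eq_single (s := dT sa sa 0) (0 : ℤ)] at this
  · simp only [if_true, Matrix.one_mulVec, sub_zero] at this
    rw [← this]
    simp only [adjCoord, hMf, Matrix.mulVec_sum, Matrix.mulVec_mulVec]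
    refine Finset.sum_congr rfl fun j _ => Finset.sum_congr rfl fun i _ => ?_
    rw [show k - (i - j) = k + j - i by ring]
  · intro l _ hl
    simp [hl]
  · intro h
    exact absurd (by simp [dT]) h

lemma corr_neg_zero (sa sb : Finset ℤ) (a b : ℤ → Matrix (Fin n) (Fin n) ℂ)
    (ha : ∀ j : ℤ, j ∉ sa → a j = 0) (hb : ∀ j : ℤ, j ∉ sb → b j = 0)
    (haU : ∀ z : ℂ, ‖z‖ = 1 → (∑ j ∈ sa, z ^ j • a j) ∈ Matrix.unitaryGroup (Fin n) ℂ)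
    (Mf Mg : KSpN n → KSpN n)
    (hMf : ∀ (x : KSpN n) (m : ℤ), Mf x m = ∑ j ∈ sa, (a j).mulVec (x (m - j)))
    (hMg : ∀ (x : KSpN n) (m : ℤ), Mg x m = ∑ j ∈ sb, (b j).mulVec (x (m - j)))
    (hW : closure (Mf '' {x : KSpN n | ∀ m : ℤ, m < 0 → x m = 0})
        = closure (Mg '' {x : KSpN n | ∀ m : ℤ, m < 0 → x m = 0}))
    (k : ℤ) (hk : k < 0) : corr sa a b k = 0 := by
  have hvan : closure (Mf '' {x : KSpN n | ∀ m : ℤ, m < 0 → x m = 0})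
      ⊆ {y | adjCoord sa a k y = 0} := by
    refine closure_minimal ?_ (isClosed_eq (adjCoord_cont sa a k) continuous_const)
    rintro _ ⟨x, hx, rfl⟩
    simp [adjCoord_Mf sa a ha haU Mf hMf, hx k hk]
  refine Matrix.ext_of_mulVec_single fun i => ?_
  set v : Fin n → ℂ := Pi.single i 1 with hv
  set e : KSpN n := lp.single 2 (0 : ℤ) (WithLp.toLp 2 v) with he
  have hee : ∀ m, e m = if m = 0 then WithLp.toLp 2 v else 0 := by
    intro m
    rw [he, lp.single_apply]
    split_ifs with h
    · subst h; simp
    · simp [h]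
  have hmem : Mg e ∈ closure (Mf '' {x : KSpN n | ∀ m : ℤ, m < 0 → x m = 0}) := by
    rw [hW]
    refine subset_closure ⟨e, ?_, rfl⟩
    intro m hm
    rw [hee, if_neg hm.ne]
  have h0 := hvan hmem
  have hge : ∀ m, (Mg e m).ofLp = b m *ᵥ v := by
    intro m
    rw [hMg, Finset.sum_eq_single m]
    · simp [hee]
    · intro j _ hj
      rw [hee, if_neg (by omega)]
      simp
    · intro hm
      simp [hb m hm]
  simp only [Set.mem_setOf_eq, adjCoord, hge, Matrix.mulVec_mulVec] at h0
  rw [← Matrix.sum_mulVec] at h0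
  simpa [corr] using h0

lemma corr_symm (sa sb : Finset ℤ) (a b : ℤ → Matrix (Fin n) (Fin n) ℂ)
    (ha : ∀ j : ℤ, j ∉ sa → a j = 0) (hb : ∀ j : ℤ, j ∉ sb → b j = 0) (k : ℤ) :
    corr sa a b k = (corr sb b a (-k))ᴴ := by
  simp only [corr, Matrix.conjTranspose_sum, Matrix.conjTranspose_mul,
    Matrix.conjTranspose_conjTranspose]
  refine Finset.sum_bij_ne_zero (fun j _ _ => k + j) ?_ ?_ ?_ ?_
  · intro j _ h
    by_contra hn
    exact h (by rw [hb _ hn, mul_zero])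
  · intro x _ _ y _ _ h
    simpa using h
  · intro i _ h
    refine ⟨-k + i, ?_, ?_, by ring⟩
    · by_contra hn
      exact h (by rw [ha _ hn]; simp)
    · simpa using h
  · intro j _ _
    simp

end Helpers

/-- A based polynomial unitary loop is uniquely determined by its
associated subspace in the Grassmannian: if `f(z) = ∑_j a_j z^j` and `g(z) = ∑_j b_j z^j`
are matrix Laurent polynomials, unitary on the unit circle and equal to the identity at
`z = 1`, and if `closure (M_f K₊) = closure (M_g K₊)`, then `a_j = b_j` for all `j`. -/
theorem poly_loop_determined_by_subspace
    (n : ℕ) (hn : 1 ≤ n)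
    (sa sb : Finset ℤ) (a b : ℤ → Matrix (Fin n) (Fin n) ℂ)
    (ha : ∀ j : ℤ, j ∉ sa → a j = 0) (hb : ∀ j : ℤ, j ∉ sb → b j = 0)
    (haU : ∀ z : ℂ, ‖z‖ = 1 → (∑ j ∈ sa, z ^ j • a j) ∈ Matrix.unitaryGroup (Fin n) ℂ)
    (hbU : ∀ z : ℂ, ‖z‖ = 1 → (∑ j ∈ sb, z ^ j • b j) ∈ Matrix.unitaryGroup (Fin n) ℂ)
    (ha1 : ∑ j ∈ sa, a j = 1) (hb1 : ∑ j ∈ sb, b j = 1)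
    (Mf Mg : KSpN n → KSpN n)
    (hMf : ∀ (x : KSpN n) (m : ℤ), Mf x m = ∑ j ∈ sa, (a j).mulVec (x (m - j)))
    (hMg : ∀ (x : KSpN n) (m : ℤ), Mg x m = ∑ j ∈ sb, (b j).mulVec (x (m - j)))
    (hW : closure (Mf '' {x : KSpN n | ∀ m : ℤ, m < 0 → x m = 0})
        = closure (Mg '' {x : KSpN n | ∀ m : ℤ, m < 0 → x m = 0})) :
    ∀ j : ℤ, a j = b j := by
  have hcorr : ∀ k, k ≠ 0 → corr sa a b k = 0 := by
    intro k hk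
    rcases lt_or_gt_of_ne hk with h | h
    · exact corr_neg_zero sa sb a b ha hb haU Mf Mg hMf hMg hW k h
    · rw [corr_symm sa sb a b ha hb,
        corr_neg_zero sb sa b a hb ha hbU Mg Mf hMg hMf hW.symm (-k) (by omega)]
      simp
  have hconst : ∀ z : ℂ, ‖z‖ = 1 →
      star (∑ j ∈ sa, z ^ j • a j) * (∑ j ∈ sb, z ^ j • b j) = corr sa a b 0 := by
    intro z hz
    rw [star_mul_eval sa sb 0 a b hb z hz, Finset.sum_eq_single (0 : ℤ)]
    · simp
    · intro l _ hl
      rw [hcorr l hl, smul_zero]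
    · intro h
      exact absurd (by simp [dT]) h
  have h1 : corr sa a b 0 = 1 := by
    have := hconst 1 (by simp)
    simpa [ha1, hb1] using this.symm
  have hfg : ∀ z : ℂ, ‖z‖ = 1 → ∑ j ∈ sa, z ^ j • a j = ∑ j ∈ sb, z ^ j • b j := by
    intro z hz
    have h2 := hconst z hz
    have h3 := Matrix.mem_unitaryGroup_iff.1 (haU z hz)
    rw [h1] at h2
    calc ∑ j ∈ sa, z ^ j • a j = (∑ j ∈ sa, z ^ j • a j) *
          (star (∑ j ∈ sa, z ^ j • a j) * (∑ j ∈ sb, z ^ j • b j)) := by rw [h2, mul_one]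
      _ = _ := by rw [← mul_assoc, h3, one_mul]
  intro j
  set T : Finset ℤ := insert 0 (insert j (sa ∪ sb)) with hT
  have hz := laurent_const T (fun j => a j - b j) 0 (by simp [hT]) ?_ j (by simp [hT])
  · simpa [sub_eq_zero] using hz
  · intro z hz
    simp only [smul_sub, Finset.sum_sub_distrib]
    rw [sub_eq_zero, ← Finset.sum_subset (s₁ := sa) (s₂ := T), hfg z hz]
    · refine Finset.sum_subset ?_ ?_
      · intro x hx; simp [hT, hx]
      · intro x _ hx; simp [hb x hx]
    · intro x hx; simp [hT, hx]
    · intro x _ hx; simp [ha x hx]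

end
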